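/- Let F : Ω → ℝ^{n+1} be a hypersurface translating soliton with respect to the unit vector W, and S(x) = ⟨F(x), W⟩. Suppose there exists a real constant a > 0 such that a(a−1) − a²H² + |A|² ≤ 0 at every point of Ω. Then F is stable: for every smooth compactly supported function f on Ω, ∫_Ω ( Σ_{i,j} g^{ij} ∂_i f ∂_j f − |A|² f² ) e^{−S} √g dx ≥ 0, where dx is Lebesgue measure on Ω. -/

import Mathlib

open Real MeasureTheory

noncomputable section

/-- Partial derivative of a scalar function in the `i`-th coordinate direction. -/
def pd {n : ℕ} (i : Fin n) (φ : (Fin n → ℝ) → ℝ) (x : Fin n → ℝ) : ℝ :=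
  fderiv ℝ φ x (Pi.single i 1)

/-- Induced metric `g_{ij} = ⟨∂_i F, ∂_j F⟩`. -/
def gmat {n m : ℕ} (F : (Fin n → ℝ) → (Fin m → ℝ)) (x : Fin n → ℝ) :
    Matrix (Fin n) (Fin n) ℝ :=
  Matrix.of fun i j => ∑ a, pd i (fun y => F y a) x * pd j (fun y => F y a) x

/-- Inverse metric `g^{ij}`. -/
def ginv {n m : ℕ} (F : (Fin n → ℝ) → (Fin m → ℝ)) (x : Fin n → ℝ) :
    Matrix (Fin n) (Fin n) ℝ :=
  (gmat F x)⁻¹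

/-- Laplace–Beltrami operator `Δ_g φ = g^{-1/2} Σ_{i,j} ∂_i (g^{1/2} g^{ij} ∂_j φ)`. -/
def lapB {n m : ℕ} (F : (Fin n → ℝ) → (Fin m → ℝ)) (φ : (Fin n → ℝ) → ℝ)
    (x : Fin n → ℝ) : ℝ :=
  (Real.sqrt (gmat F x).det)⁻¹ *
    ∑ i, ∑ j, pd i (fun y => Real.sqrt (gmat F y).det * ginv F y i j * pd j φ y) x

/-- Mean curvature vector `H̄ = Δ_g F` (componentwise). -/
def Hvec {n m : ℕ} (F : (Fin n → ℝ) → (Fin m → ℝ)) (x : Fin n → ℝ) : Fin m → ℝ :=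
  fun a => lapB F (fun y => F y a) x

/-- Tangential projection of an ambient vector `V` onto `span{∂_1 F(x), …, ∂_n F(x)}`:
`V^⊤ = Σ_{i,j} g^{ij} ⟨V, ∂_j F⟩ ∂_i F`. -/
def tproj {n m : ℕ} (F : (Fin n → ℝ) → (Fin m → ℝ)) (x : Fin n → ℝ)
    (V : Fin m → ℝ) : Fin m → ℝ :=
  fun a => ∑ i, ∑ j, ginv F x i j * (∑ b, V b * pd j (fun y => F y b) x)
      * pd i (fun y => F y a) x

/-- `S(x) = ⟨F(x), W⟩`. -/
def Sfun {n m : ℕ} (F : (Fin n → ℝ) → (Fin m → ℝ)) (W : Fin m → ℝ)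
    (x : Fin n → ℝ) : ℝ :=
  ∑ a, F x a * W a

/-- Second fundamental form `h_{ij} = ⟨∂_i ν, ∂_j F⟩`. -/
def sff {n m : ℕ} (F ν : (Fin n → ℝ) → (Fin m → ℝ)) (i j : Fin n) (x : Fin n → ℝ) : ℝ :=
  ∑ a, pd i (fun y => ν y a) x * pd j (fun y => F y a) x

/-- Scalar mean curvature `H = Σ_{i,j} g^{ij} h_{ij}`. -/
def meanH {n m : ℕ} (F ν : (Fin n → ℝ) → (Fin m → ℝ)) (x : Fin n → ℝ) : ℝ :=
  ∑ i, ∑ j, ginv F x i j * sff F ν i j x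

/-- `|A|² = Σ g^{ik} g^{jl} h_{ij} h_{kl}`. -/
def normA2 {n m : ℕ} (F ν : (Fin n → ℝ) → (Fin m → ℝ)) (x : Fin n → ℝ) : ℝ :=
  ∑ i, ∑ j, ∑ k, ∑ l, ginv F x i k * ginv F x j l * sff F ν i j x * sff F ν k l x

open Topology

section PartialDerivatives

variable {n : ℕ} {x : Fin n → ℝ} {φ ψ : (Fin n → ℝ) → ℝ}

lemma pd_mul (i : Fin n) (hφ : DifferentiableAt ℝ φ x) (hψ : DifferentiableAt ℝ ψ x) :
    pd i (fun y => φ y * ψ y) x = pd i φ x * ψ x + φ x * pd i ψ x := by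
  simp only [pd, fderiv_fun_mul hφ hψ, add_apply, smul_apply, smul_eq_mul]
  ring

lemma pd_mul_const (i : Fin n) (c : ℝ) (hφ : DifferentiableAt ℝ φ x) :
    pd i (fun y => φ y * c) x = pd i φ x * c := by
  rw [pd, fderiv_fun_mul hφ (differentiableAt_const c)]
  simp [pd, mul_comm]

lemma pd_const (i : Fin n) (c : ℝ) : pd i (fun _ => c) x = 0 := by
  simp [pd]

lemma pd_sum {ι : Type*} (s : Finset ι) (i : Fin n) {Φ : ι → (Fin n → ℝ) → ℝ}
    (h : ∀ b ∈ s, DifferentiableAt ℝ (Φ b) x) :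
    pd i (fun y => ∑ b ∈ s, Φ b y) x = ∑ b ∈ s, pd i (Φ b) x := by
  simp [pd, fderiv_fun_sum h]

lemma pd_congr (i : Fin n) (h : φ =ᶠ[𝓝 x] ψ) : pd i φ x = pd i ψ x := by
  simp only [pd, h.fderiv_eq]

lemma pd_comp {θ : ℝ → ℝ} {θ' : ℝ} (i : Fin n) (hθ : HasDerivAt θ θ' (φ x))
    (hφ : DifferentiableAt ℝ φ x) : pd i (fun y => θ (φ y)) x = θ' * pd i φ x := by
  have h := hθ.comp_hasFDerivAt x hφ.hasFDerivAt
  simp only [pd]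
  rw [show (fun y => θ (φ y)) = θ ∘ φ from rfl, h.fderiv]
  simp

lemma contDiffAt_pd (i : Fin n) (hφ : ContDiffAt ℝ (⊤ : ℕ∞) φ x) :
    ContDiffAt ℝ (⊤ : ℕ∞) (pd i φ) x :=
  (hφ.fderiv_right (m := (⊤ : ℕ∞)) (by simp)).clm_apply contDiffAt_const

lemma ContDiffAt.diffAt (hφ : ContDiffAt ℝ (⊤ : ℕ∞) φ x) : DifferentiableAt ℝ φ x :=
  hφ.differentiableAt (by simp)

lemma pd_comm (i j : Fin n) (hφ : ContDiffAt ℝ (⊤ : ℕ∞) φ x) :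
    pd i (pd j φ) x = pd j (pd i φ) x := by
  have hd : DifferentiableAt ℝ (fderiv ℝ φ) x :=
    (hφ.fderiv_right (m := (⊤ : ℕ∞)) (by simp)).differentiableAt (by simp)
  have key (k l : Fin n) :
      pd k (pd l φ) x = fderiv ℝ (fderiv ℝ φ) x (Pi.single k 1) (Pi.single l 1) := by
    unfold pd
    rw [fderiv_clm_apply hd (differentiableAt_const _)]
    simp
  rw [key, key]
  exact hφ.isSymmSndFDerivAt (by simpa using WithTop.coe_le_coe.2 (le_top : (2 : ℕ∞) ≤ ⊤)) _ _

/-- Jacobi's formula for the derivative of a determinant. -/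
lemma pd_det {m : ℕ} {M : (Fin n → ℝ) → Matrix (Fin m) (Fin m) ℝ}
    (hM : ∀ i j, DifferentiableAt ℝ (fun y => M y i j) x) (k : Fin n) :
    pd k (fun y => (M y).det) x
      = ∑ i, ∑ j, (M x).adjugate j i * pd k (fun y => M y i j) x := by
  let D : ContinuousMultilinearMap ℝ (fun _ : Fin m => Fin m → ℝ) ℝ :=
    { toMultilinearMap :=
        (Matrix.detRowAlternating : (Fin m → ℝ) [⋀^Fin m]→ₗ[ℝ] ℝ).toMultilinearMap
      cont := by
        show Continuous fun A : Matrix (Fin m) (Fin m) ℝ => A.det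
        exact Continuous.matrix_det continuous_id }
  have hM' : HasFDerivAt (fun y => (fun i j => M y i j : Fin m → Fin m → ℝ))
      (ContinuousLinearMap.pi fun i => ContinuousLinearMap.pi fun j =>
        fderiv ℝ (fun y => M y i j) x) x :=
    hasFDerivAt_pi.2 fun i => hasFDerivAt_pi.2 fun j => (hM i j).hasFDerivAt
  have h := (D.hasFDerivAt (fun i j => M x i j)).comp x hM'
  have h2 : (fun y => (M y).det) = D ∘ fun y => (fun i j => M y i j : Fin m → Fin m → ℝ) := rfl
  simp only [pd]
  rw [h2, h.fderiv]
  simp only [ContinuousLinearMap.comp_apply, ContinuousMultilinearMap.linearDeriv_apply]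
  refine Finset.sum_congr rfl fun i _ => ?_
  show ((M x).updateRow i _).det = _
  rw [← Matrix.det_transpose, ← Matrix.updateCol_transpose, ← Matrix.cramer_apply,
    Matrix.cramer_eq_adjugate_mulVec, ← Matrix.adjugate_transpose]
  rfl

end PartialDerivatives

section Smoothness

variable {n m : ℕ} {x : Fin n → ℝ}

lemma contDiffAt_det {M : (Fin n → ℝ) → Matrix (Fin m) (Fin m) ℝ}
    (hM : ∀ i j, ContDiffAt ℝ (⊤ : ℕ∞) (fun y => M y i j) x) :
    ContDiffAt ℝ (⊤ : ℕ∞) (fun y => (M y).det) x := by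
  simp only [Matrix.det_apply']
  exact ContDiffAt.sum fun σ _ => contDiffAt_const.mul (contDiffAt_prod fun i _ => hM _ _)

lemma contDiffAt_adjugate {M : (Fin n → ℝ) → Matrix (Fin m) (Fin m) ℝ}
    (hM : ∀ i j, ContDiffAt ℝ (⊤ : ℕ∞) (fun y => M y i j) x) (i j : Fin m) :
    ContDiffAt ℝ (⊤ : ℕ∞) (fun y => (M y).adjugate i j) x := by
  simp only [Matrix.adjugate_apply]
  refine contDiffAt_det fun k l => ?_
  by_cases hk : k = j
  · subst hk
    simpa using contDiffAt_const
  · simpa [Matrix.updateRow_ne hk] using hM k l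

lemma contDiffAt_matrix_inv {M : (Fin n → ℝ) → Matrix (Fin m) (Fin m) ℝ}
    (hM : ∀ i j, ContDiffAt ℝ (⊤ : ℕ∞) (fun y => M y i j) x) (hdet : (M x).det ≠ 0)
    (i j : Fin m) : ContDiffAt ℝ (⊤ : ℕ∞) (fun y => (M y)⁻¹ i j) x := by
  simp only [Matrix.inv_def, Ring.inverse_eq_inv', Matrix.smul_apply, smul_eq_mul]
  exact ((contDiffAt_det hM).inv hdet).mul (contDiffAt_adjugate hM i j)

lemma contDiffAt_gmat {F : (Fin n → ℝ) → (Fin m → ℝ)}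
    (hF : ∀ a, ContDiffAt ℝ (⊤ : ℕ∞) (fun y => F y a) x) (i j : Fin n) :
    ContDiffAt ℝ (⊤ : ℕ∞) (fun y => gmat F y i j) x := by
  simp only [gmat, Matrix.of_apply]
  exact ContDiffAt.sum fun a _ => (contDiffAt_pd i (hF a)).mul (contDiffAt_pd j (hF a))

end Smoothness

section Divergence

variable {n : ℕ}

lemma integral_pd_eq_zero (i : Fin n) {Y : (Fin n → ℝ) → ℝ} (hY : ContDiff ℝ 1 Y)
    (hc : HasCompactSupport Y) : Integrable (pd i Y) ∧ ∫ x, pd i Y x = 0 := by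
  have hcont : Continuous (pd i Y) := by
    unfold pd
    exact (hY.continuous_fderiv (by simp)).clm_apply continuous_const
  have hcs : HasCompactSupport (pd i Y) := hc.fderiv_apply ℝ _
  have hint : Integrable (pd i Y) := hcont.integrable_of_hasCompactSupport hcs
  refine ⟨hint, ?_⟩
  have h := integral_mul_fderiv_eq_neg_fderiv_mul_of_integrable (μ := volume)
    (f := fun _ : Fin n → ℝ => (1 : ℝ)) (g := Y) (v := Pi.single i 1)
    (by simp) (by simp only [one_mul]; exact hint)
    (by simpa using hY.continuous.integrable_of_hasCompactSupport hc)
    (fun _ _ => differentiableAt_const _) (fun y _ => hY.differentiable (by simp) y)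
  simpa [pd] using h

end Divergence

section Frame

variable {n m : ℕ}

/-- The Jacobian matrix `(∂_i F_a)`. -/
def jac (F : (Fin n → ℝ) → (Fin m → ℝ)) (x : Fin n → ℝ) : Matrix (Fin n) (Fin m) ℝ :=
  Matrix.of fun i a => pd i (fun y => F y a) x

lemma gmat_eq_jac_mul_transpose (F : (Fin n → ℝ) → (Fin m → ℝ)) (x : Fin n → ℝ) :
    gmat F x = jac F x * (jac F x).transpose := by
  ext i j
  simp [gmat, jac, Matrix.mul_apply]

lemma gmat_symm (F : (Fin n → ℝ) → (Fin m → ℝ)) (x : Fin n → ℝ) (i j : Fin n) :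
    gmat F x i j = gmat F x j i := by
  simp [gmat, mul_comm]

lemma ginv_symm (F : (Fin n → ℝ) → (Fin m → ℝ)) (x : Fin n → ℝ) (i j : Fin n) :
    ginv F x i j = ginv F x j i := by
  have h : (gmat F x).transpose = gmat F x := by
    ext i j
    exact gmat_symm F x j i
  have h2 : (ginv F x).transpose = ginv F x := by
    rw [ginv, Matrix.transpose_nonsing_inv, h]
  exact congrFun (congrFun h2 j) i

lemma ginv_mul_gmat {F : (Fin n → ℝ) → (Fin m → ℝ)} {x : Fin n → ℝ}
    (h : (gmat F x).PosDef) : ginv F x * gmat F x = 1 :=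
  Matrix.nonsing_inv_mul _ h.det_pos.ne'.isUnit

lemma adjugate_gmat {F : (Fin n → ℝ) → (Fin m → ℝ)} {x : Fin n → ℝ}
    (h : (gmat F x).PosDef) (i j : Fin n) :
    (gmat F x).adjugate i j = (gmat F x).det * ginv F x i j := by
  simp [ginv, Matrix.inv_def, Ring.inverse_eq_inv', mul_inv_cancel_left₀ h.det_pos.ne']

/-- The tangent vectors together with the unit normal resolve the identity. -/
lemma tangent_add_normal_eq_one {F : (Fin n → ℝ) → (Fin (n + 1) → ℝ)} {x : Fin n → ℝ}
    (h : (gmat F x).PosDef) {N : Fin (n + 1) → ℝ} (hN : ∑ a, N a ^ 2 = 1)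
    (hperp : ∀ i, ∑ a, N a * pd i (fun y => F y a) x = 0) :
    (jac F x).transpose * ginv F x * jac F x + Matrix.vecMulVec N N = 1 := by
  have hJN : jac F x * Matrix.replicateCol Unit N = 0 := by
    ext i u
    simpa [jac, Matrix.mul_apply, mul_comm] using hperp i
  have hNJ : Matrix.replicateRow Unit N * (jac F x).transpose = 0 := by
    rw [← Matrix.transpose_inj, Matrix.transpose_mul]
    simpa using hJN
  have hNN : Matrix.replicateRow Unit N * Matrix.replicateCol Unit N = 1 := by
    ext u v
    simpa [Matrix.mul_apply, ← pow_two] using hN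
  have hG : jac F x * ((jac F x).transpose * ginv F x) = 1 := by
    rw [← Matrix.mul_assoc, ← gmat_eq_jac_mul_transpose]
    exact Matrix.mul_nonsing_inv _ h.det_pos.ne'.isUnit
  have hBC : Matrix.fromRows (jac F x) (Matrix.replicateRow Unit N)
      * Matrix.fromCols ((jac F x).transpose * ginv F x) (Matrix.replicateCol Unit N) = 1 := by
    rw [Matrix.fromRows_mul_fromCols, hG, hJN, hNN, ← Matrix.mul_assoc, hNJ, Matrix.zero_mul,
      Matrix.fromBlocks_one]
  have hCB := (Matrix.mul_eq_one_comm_of_card_eq _ _ _ (by simp)).1 hBC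
  rw [Matrix.fromCols_mul_fromRows] at hCB
  rw [← hCB, Matrix.vecMulVec_eq Unit]

lemma dotProduct_eq_tangent_add_normal {F : (Fin n → ℝ) → (Fin (n + 1) → ℝ)} {x : Fin n → ℝ}
    (h : (gmat F x).PosDef) {N : Fin (n + 1) → ℝ} (hN : ∑ a, N a ^ 2 = 1)
    (hperp : ∀ i, ∑ a, N a * pd i (fun y => F y a) x = 0) (U V : Fin (n + 1) → ℝ) :
    U ⬝ᵥ V = (jac F x).mulVec U ⬝ᵥ (ginv F x).mulVec ((jac F x).mulVec V)
      + (N ⬝ᵥ U) * (N ⬝ᵥ V) := by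
  conv_lhs => rw [← Matrix.one_mulVec V, ← tangent_add_normal_eq_one h hN hperp]
  rw [Matrix.add_mulVec, dotProduct_add, ← Matrix.mulVec_mulVec, ← Matrix.mulVec_mulVec,
    Matrix.dotProduct_mulVec, Matrix.vecMul_transpose, Matrix.vecMulVec_mulVec]
  simp [dotProduct_comm U N, mul_comm]

end Frame

section MeanCurvature

variable {n m : ℕ} {Ω : Set (Fin n → ℝ)} {x : Fin n → ℝ}

/-- The densitized gradient `√g g^{ij} ∂_j F_b` of the component `F_b`. -/
def flux (F : (Fin n → ℝ) → (Fin m → ℝ)) (i : Fin n) (b : Fin m) (x : Fin n → ℝ) : ℝ :=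
  ∑ j, √(gmat F x).det * ginv F x i j * pd j (fun y => F y b) x

lemma contDiffAt_sqrt_det_gmat {F : (Fin n → ℝ) → (Fin m → ℝ)}
    (hF : ∀ a, ContDiffAt ℝ (⊤ : ℕ∞) (fun y => F y a) x) (hx : (gmat F x).PosDef) :
    ContDiffAt ℝ (⊤ : ℕ∞) (fun y => √(gmat F y).det) x :=
  (contDiffAt_det (contDiffAt_gmat hF)).sqrt hx.det_pos.ne'

lemma contDiffAt_flux {F : (Fin n → ℝ) → (Fin m → ℝ)}
    (hF : ∀ a, ContDiffAt ℝ (⊤ : ℕ∞) (fun y => F y a) x) (hx : (gmat F x).PosDef)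
    (i : Fin n) (b : Fin m) : ContDiffAt ℝ (⊤ : ℕ∞) (flux F i b) x :=
  ContDiffAt.sum fun j _ => ((contDiffAt_sqrt_det_gmat hF hx).mul
    (contDiffAt_matrix_inv (contDiffAt_gmat hF) hx.det_pos.ne' i j)).mul (contDiffAt_pd j (hF b))

lemma sum_flux_mul_pd {F : (Fin n → ℝ) → (Fin m → ℝ)} (hx : (gmat F x).PosDef) (i k : Fin n) :
    ∑ b, flux F i b x * pd k (fun y => F y b) x = √(gmat F x).det * if i = k then 1 else 0 := by
  have h := congrFun (congrFun (ginv_mul_gmat hx) i) k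
  rw [Matrix.one_apply, Matrix.mul_apply] at h
  rw [← h, Finset.mul_sum]
  simp only [flux, Finset.sum_mul]
  rw [Finset.sum_comm]
  refine Finset.sum_congr rfl fun j _ => ?_
  simp only [gmat, Matrix.of_apply, Finset.mul_sum]
  exact Finset.sum_congr rfl fun b _ => by ring

lemma pd_sqrt_det_gmat {F : (Fin n → ℝ) → (Fin m → ℝ)}
    (hF : ∀ a, ContDiffAt ℝ (⊤ : ℕ∞) (fun y => F y a) x) (hx : (gmat F x).PosDef) (k : Fin n) :
    pd k (fun y => √(gmat F y).det) x
      = ∑ i, ∑ b, flux F i b x * pd i (pd k fun y => F y b) x := by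
  have hg (i j : Fin n) : pd k (fun y => gmat F y i j) x
      = ∑ b, (pd i (pd k fun y => F y b) x * pd j (fun y => F y b) x
        + pd i (fun y => F y b) x * pd j (pd k fun y => F y b) x) := by
    simp only [gmat, Matrix.of_apply]
    rw [pd_sum _ _ fun b _ =>
      ((contDiffAt_pd i (hF b)).mul (contDiffAt_pd j (hF b))).diffAt]
    refine Finset.sum_congr rfl fun b _ => ?_
    rw [pd_mul _ (contDiffAt_pd i (hF b)).diffAt (contDiffAt_pd j (hF b)).diffAt,
      pd_comm i k (hF b), pd_comm j k (hF b)]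
  have hpos := hx.det_pos
  have hs : √(gmat F x).det * √(gmat F x).det = (gmat F x).det := Real.mul_self_sqrt hpos.le
  have hs0 : √(gmat F x).det ≠ 0 := (Real.sqrt_pos.2 hpos).ne'
  have hsum : ∑ i, ∑ b, flux F i b x * pd i (pd k fun y => F y b) x
      = √(gmat F x).det * ∑ i, ∑ j, ginv F x i j
        * ∑ b, pd i (pd k fun y => F y b) x * pd j (fun y => F y b) x := by
    simp only [flux, Finset.mul_sum, Finset.sum_mul]
    refine Finset.sum_congr rfl fun i _ => ?_
    rw [Finset.sum_comm]
    exact Finset.sum_congr rfl fun j _ => Finset.sum_congr rfl fun b _ => by ring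
  have hsymm : ∑ i, ∑ j, ginv F x i j
        * ∑ b, pd i (fun y => F y b) x * pd j (pd k fun y => F y b) x
      = ∑ i, ∑ j, ginv F x i j
        * ∑ b, pd i (pd k fun y => F y b) x * pd j (fun y => F y b) x := by
    rw [Finset.sum_comm]
    refine Finset.sum_congr rfl fun i _ => Finset.sum_congr rfl fun j _ => ?_
    rw [ginv_symm]
    simp only [mul_comm]
  rw [pd_comp k (Real.hasDerivAt_sqrt hpos.ne') (contDiffAt_det (contDiffAt_gmat hF)).diffAt,
    pd_det (fun i j => (contDiffAt_gmat hF i j).diffAt), hsum]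
  have hdet : ∑ i, ∑ j, (gmat F x).adjugate j i * pd k (fun y => gmat F y i j) x
      = (gmat F x).det * (2 * ∑ i, ∑ j, ginv F x i j
        * ∑ b, pd i (pd k fun y => F y b) x * pd j (fun y => F y b) x) := by
    rw [two_mul]
    nth_rewrite 2 [← hsymm]
    simp only [adjugate_gmat hx, hg, Finset.sum_add_distrib, mul_add, Finset.mul_sum,
      ginv_symm F x, mul_assoc]
  rw [hdet]
  nth_rewrite 2 [← hs]
  field_simp

/-- The vector `√g Δ_g F` has no tangential component. -/
lemma jac_mulVec_divergence_flux (hΩ : IsOpen Ω) {F : (Fin n → ℝ) → (Fin m → ℝ)}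
    (hF : ∀ y ∈ Ω, ∀ a, ContDiffAt ℝ (⊤ : ℕ∞) (fun y => F y a) y)
    (himm : ∀ y ∈ Ω, (gmat F y).PosDef) (hx : x ∈ Ω) :
    (jac F x).mulVec (fun b => ∑ i, pd i (flux F i b) x) = 0 := by
  ext k
  have hi (i : Fin n) : ∑ b, pd i (flux F i b) x * pd k (fun y => F y b) x
      = pd i (fun y => √(gmat F y).det) x * (if i = k then 1 else 0)
        - ∑ b, flux F i b x * pd i (pd k fun y => F y b) x := by
    have hfl (b : Fin m) := (contDiffAt_flux (hF x hx) (himm x hx) i b).diffAt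
    have hpd (b : Fin m) := (contDiffAt_pd k (hF x hx b)).diffAt
    have h := pd_congr i (φ := fun y => ∑ b, flux F i b y * pd k (fun y => F y b) y)
      (ψ := fun y => √(gmat F y).det * if i = k then 1 else 0) (x := x) <| by
        filter_upwards [hΩ.mem_nhds hx] with y hy
        exact sum_flux_mul_pd (himm y hy) i k
    rw [pd_mul_const _ _ (contDiffAt_sqrt_det_gmat (hF x hx) (himm x hx)).diffAt,
      pd_sum _ _ fun b _ => (hfl b).fun_mul (hpd b)] at h
    rw [← h, ← Finset.sum_sub_distrib]
    exact Finset.sum_congr rfl fun b _ => by rw [pd_mul i (hfl b) (hpd b)]; ring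
  have hsum := pd_sqrt_det_gmat (hF x hx) (himm x hx) k
  calc (jac F x).mulVec (fun b => ∑ i, pd i (flux F i b) x) k
      = ∑ i, ∑ b, pd i (flux F i b) x * pd k (fun y => F y b) x := by
        simp only [Matrix.mulVec, dotProduct, jac, Matrix.of_apply, Finset.mul_sum]
        rw [Finset.sum_comm]
        simp only [mul_comm]
    _ = 0 := by simp [hi, Finset.sum_sub_distrib, hsum]

/-- The normal component of `√g Δ_g F` is `-√g H`. -/
lemma normal_dotProduct_divergence_flux (hΩ : IsOpen Ω) {F ν : (Fin n → ℝ) → (Fin m → ℝ)}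
    (hF : ∀ y ∈ Ω, ∀ a, ContDiffAt ℝ (⊤ : ℕ∞) (fun y => F y a) y)
    (himm : ∀ y ∈ Ω, (gmat F y).PosDef)
    (hν : ∀ y ∈ Ω, ∀ a, ContDiffAt ℝ (⊤ : ℕ∞) (fun y => ν y a) y)
    (hperp : ∀ y ∈ Ω, ∀ i, ∑ a, ν y a * pd i (fun y => F y a) y = 0) (hx : x ∈ Ω) :
    ν x ⬝ᵥ (fun b => ∑ i, pd i (flux F i b) x) = -(√(gmat F x).det * meanH F ν x) := by
  have hi (i : Fin n) : ∑ b, ν x b * pd i (flux F i b) x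
      = -∑ b, pd i (fun y => ν y b) x * flux F i b x := by
    have hfl (b : Fin m) := (contDiffAt_flux (hF x hx) (himm x hx) i b).diffAt
    have hn (b : Fin m) := (hν x hx b).diffAt
    have h := pd_congr i (φ := fun y => ∑ b, ν y b * flux F i b y)
      (ψ := fun _ => 0) (x := x) <| by
        filter_upwards [hΩ.mem_nhds hx] with y hy
        simp only [flux, Finset.mul_sum]
        rw [Finset.sum_comm]
        refine Finset.sum_eq_zero fun j _ => ?_
        rw [← mul_zero (√(gmat F y).det * ginv F y i j), ← hperp y hy j, Finset.mul_sum]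
        exact Finset.sum_congr rfl fun b _ => by ring
    rw [pd_const, pd_sum _ _ fun b _ => (hn b).fun_mul (hfl b)] at h
    rw [eq_neg_iff_add_eq_zero, ← h, ← Finset.sum_add_distrib]
    exact Finset.sum_congr rfl fun b _ => by rw [pd_mul i (hn b) (hfl b)]; ring
  simp only [dotProduct, Finset.mul_sum]
  rw [Finset.sum_comm]
  simp only [hi, Finset.sum_neg_distrib, meanH, sff, flux, Finset.mul_sum]
  congr 1
  refine Finset.sum_congr rfl fun i _ => ?_
  rw [Finset.sum_comm]
  exact Finset.sum_congr rfl fun j _ => Finset.sum_congr rfl fun b _ => by ring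

end MeanCurvature

section Weighted

variable {n : ℕ} {Ω : Set (Fin n → ℝ)} {x : Fin n → ℝ}

lemma contDiffAt_Sfun {m : ℕ} {F : (Fin n → ℝ) → (Fin m → ℝ)}
    (hF : ∀ a, ContDiffAt ℝ (⊤ : ℕ∞) (fun y => F y a) x) (W : Fin m → ℝ) :
    ContDiffAt ℝ (⊤ : ℕ∞) (Sfun F W) x :=
  ContDiffAt.sum fun a _ => (hF a).mul contDiffAt_const

lemma pd_Sfun {m : ℕ} {F : (Fin n → ℝ) → (Fin m → ℝ)}
    (hF : ∀ a, ContDiffAt ℝ (⊤ : ℕ∞) (fun y => F y a) x) (W : Fin m → ℝ) (i : Fin n) :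
    pd i (Sfun F W) x = (jac F x).mulVec W i := by
  unfold Sfun
  rw [pd_sum _ _ fun a _ => (hF a).diffAt.mul_const _]
  exact Finset.sum_congr rfl fun a _ => pd_mul_const _ _ (hF a).diffAt

lemma sum_mul_flux {m : ℕ} (F : (Fin n → ℝ) → (Fin m → ℝ)) (W : Fin m → ℝ) (i : Fin n) :
    ∑ b, W b * flux F i b x
      = √(gmat F x).det * (ginv F x).mulVec ((jac F x).mulVec W) i := by
  simp only [flux, Matrix.mulVec, dotProduct, jac, Matrix.of_apply, Finset.mul_sum]
  rw [Finset.sum_comm]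
  exact Finset.sum_congr rfl fun j _ => Finset.sum_congr rfl fun b _ => by ring

/-- The densitized weighted gradient `f² e^{-S} √g ∇S`. -/
def weightedFlux {m : ℕ} (F : (Fin n → ℝ) → (Fin m → ℝ)) (W : Fin m → ℝ)
    (f : (Fin n → ℝ) → ℝ) (i : Fin n) (x : Fin n → ℝ) : ℝ :=
  f x * f x * (Real.exp (-Sfun F W x) * ∑ b, W b * flux F i b x)

lemma contDiffAt_weightedFlux {m : ℕ} {F : (Fin n → ℝ) → (Fin m → ℝ)} {f : (Fin n → ℝ) → ℝ}
    (hF : ∀ a, ContDiffAt ℝ (⊤ : ℕ∞) (fun y => F y a) x) (hx : (gmat F x).PosDef)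
    (hf : ContDiffAt ℝ (⊤ : ℕ∞) f x) (W : Fin m → ℝ) (i : Fin n) :
    ContDiffAt ℝ (⊤ : ℕ∞) (weightedFlux F W f i) x :=
  (hf.mul hf).mul ((contDiffAt_Sfun hF W).neg.exp.mul
    (ContDiffAt.sum fun b _ => contDiffAt_const.mul (contDiffAt_flux hF hx i b)))

lemma pd_weightedFlux {m : ℕ} {F : (Fin n → ℝ) → (Fin m → ℝ)} {f : (Fin n → ℝ) → ℝ}
    (hF : ∀ a, ContDiffAt ℝ (⊤ : ℕ∞) (fun y => F y a) x) (hx : (gmat F x).PosDef)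
    (hf : ContDiffAt ℝ (⊤ : ℕ∞) f x) (W : Fin m → ℝ) (i : Fin n) :
    pd i (weightedFlux F W f i) x
      = Real.exp (-Sfun F W x)
        * (√(gmat F x).det * (2 * f x * pd i f x - f x ^ 2 * (jac F x).mulVec W i)
            * (ginv F x).mulVec ((jac F x).mulVec W) i
          + f x ^ 2 * ∑ b, W b * pd i (flux F i b) x) := by
  have hS := contDiffAt_Sfun hF W
  have hfl (b : Fin m) := (contDiffAt_flux hF hx i b).diffAt
  have hT : DifferentiableAt ℝ (fun y => ∑ b, W b * flux F i b y) x :=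
    DifferentiableAt.fun_sum fun b _ => (hfl b).const_mul _
  have hE : pd i (fun y => Real.exp (-Sfun F W y)) x
      = -Real.exp (-Sfun F W x) * (jac F x).mulVec W i := by
    rw [pd_comp (θ := fun t => Real.exp (-t)) i
      (by simpa using (hasDerivAt_neg (Sfun F W x)).exp) hS.diffAt, pd_Sfun hF]
  have hE' : DifferentiableAt ℝ (fun y => Real.exp (-Sfun F W y)) x := hS.neg.exp.diffAt
  unfold weightedFlux
  rw [pd_mul i (hf.diffAt.fun_mul hf.diffAt) (hE'.fun_mul hT), pd_mul i hf.diffAt hf.diffAt,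
    pd_mul i hE' hT, hE, pd_sum _ _ fun b _ => (hfl b).const_mul _, sum_mul_flux]
  have hc (b : Fin m) : pd i (fun y => W b * flux F i b y) x = W b * pd i (flux F i b) x := by
    simp only [mul_comm (W b)]
    exact pd_mul_const _ _ (hfl b)
  simp only [hc]
  ring

lemma sum_pd_weightedFlux (hΩ : IsOpen Ω) {F ν : (Fin n → ℝ) → (Fin (n + 1) → ℝ)}
    (hF : ∀ y ∈ Ω, ∀ a, ContDiffAt ℝ (⊤ : ℕ∞) (fun y => F y a) y)
    (himm : ∀ y ∈ Ω, (gmat F y).PosDef)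
    (hν : ∀ y ∈ Ω, ∀ a, ContDiffAt ℝ (⊤ : ℕ∞) (fun y => ν y a) y)
    (hunit : ∀ y ∈ Ω, ∑ a, ν y a ^ 2 = 1)
    (hperp : ∀ y ∈ Ω, ∀ i, ∑ a, ν y a * pd i (fun y => F y a) y = 0)
    {W : Fin (n + 1) → ℝ} (hW : ∑ a, W a ^ 2 = 1)
    (hsol : ∀ y ∈ Ω, meanH F ν y = ∑ a, ν y a * W a)
    {f : (Fin n → ℝ) → ℝ} (hf : ContDiffAt ℝ (⊤ : ℕ∞) f x) (hx : x ∈ Ω) :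
    ∑ i, pd i (weightedFlux F W f i) x
      = (2 * f x * ((fun i => pd i f x) ⬝ᵥ (ginv F x).mulVec ((jac F x).mulVec W)) - f x ^ 2)
        * Real.exp (-Sfun F W x) * √(gmat F x).det := by
  set q := (jac F x).mulVec W with hq
  have hH : ν x ⬝ᵥ W = meanH F ν x := (hsol x hx).symm
  have hdiv : ∑ i, ∑ b, W b * pd i (flux F i b) x
      = -(√(gmat F x).det * meanH F ν x ^ 2) := by
    have h := dotProduct_eq_tangent_add_normal (himm x hx) (hunit x hx) (hperp x hx) W
      (fun b => ∑ i, pd i (flux F i b) x)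
    rw [jac_mulVec_divergence_flux hΩ hF himm hx,
      normal_dotProduct_divergence_flux hΩ hF himm hν hperp hx, hH] at h
    rw [Finset.sum_comm]
    simp only [← Finset.mul_sum]
    refine Eq.trans h ?_
    simp
    ring
  have hgrad : q ⬝ᵥ (ginv F x).mulVec q = 1 - meanH F ν x ^ 2 := by
    have h := dotProduct_eq_tangent_add_normal (himm x hx) (hunit x hx) (hperp x hx) W W
    rw [hH, show W ⬝ᵥ W = 1 by rw [← hW]; simp [dotProduct, pow_two]] at h
    linarith
  simp only [pd_weightedFlux (hF x hx) (himm x hx) hf, ← hq, ← Finset.mul_sum,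
    Finset.sum_add_distrib, hdiv]
  have hs : ∑ i, √(gmat F x).det * (2 * f x * pd i f x - f x ^ 2 * q i)
        * (ginv F x).mulVec q i
      = √(gmat F x).det * (2 * f x * ((fun i => pd i f x) ⬝ᵥ (ginv F x).mulVec q)
        - f x ^ 2 * (q ⬝ᵥ (ginv F x).mulVec q)) := by
    simp only [dotProduct, Finset.mul_sum, ← Finset.sum_sub_distrib]
    exact Finset.sum_congr rfl fun i _ => by ring
  rw [hs, hgrad]
  ring

lemma two_mul_inner_le {F : (Fin n → ℝ) → (Fin (n + 1) → ℝ)} (hx : (gmat F x).PosDef)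
    (p q : Fin n → ℝ) (c : ℝ) :
    2 * c * (p ⬝ᵥ (ginv F x).mulVec q)
      ≤ p ⬝ᵥ (ginv F x).mulVec p + c ^ 2 * (q ⬝ᵥ (ginv F x).mulVec q) := by
  have h := hx.inv.posSemidef.dotProduct_mulVec_nonneg (p - c • q)
  have hsymm : q ⬝ᵥ (ginv F x).mulVec p = p ⬝ᵥ (ginv F x).mulVec q := by
    have ht : (ginv F x).transpose = ginv F x := by
      ext i j
      exact ginv_symm F x j i
    rw [Matrix.dotProduct_mulVec, dotProduct_comm, ← Matrix.mulVec_transpose, ht]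
  rw [star_trivial, show (gmat F x)⁻¹ = ginv F x from rfl, Matrix.mulVec_sub, Matrix.mulVec_smul,
    sub_dotProduct, dotProduct_sub, dotProduct_sub, smul_dotProduct, smul_dotProduct,
    dotProduct_smul, dotProduct_smul, hsymm] at h
  simp only [smul_eq_mul] at h
  linarith

end Weighted

/-- If `a(a−1) − a²H² + |A|² ≤ 0` on `Ω` for some constant `a > 0`,
then the hypersurface translating soliton is stable. -/
theorem soliton_stable {n : ℕ} (hn : 1 ≤ n)
    (Ω : Set (Fin n → ℝ)) (hΩo : IsOpen Ω) (hΩne : Ω.Nonempty)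
    (F : (Fin n → ℝ) → (Fin (n + 1) → ℝ)) (hF : ContDiffOn ℝ (⊤ : ℕ∞) F Ω)
    (himm : ∀ x ∈ Ω, (gmat F x).PosDef)
    (ν : (Fin n → ℝ) → (Fin (n + 1) → ℝ)) (hν : ContDiffOn ℝ (⊤ : ℕ∞) ν Ω)
    (hνunit : ∀ x ∈ Ω, ∑ a, (ν x a) ^ 2 = 1)
    (hνperp : ∀ x ∈ Ω, ∀ i, ∑ a, ν x a * pd i (fun y => F y a) x = 0)
    (W : Fin (n + 1) → ℝ) (hW : ∑ a, (W a) ^ 2 = 1)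
    (hsol : ∀ x ∈ Ω, meanH F ν x = ∑ a, ν x a * W a)
    (a : ℝ) (ha : 0 < a)
    (hq : ∀ x ∈ Ω, a * (a - 1) - a ^ 2 * (meanH F ν x) ^ 2 + normA2 F ν x ≤ 0) :
    ∀ f : (Fin n → ℝ) → ℝ, ContDiff ℝ (⊤ : ℕ∞) f → HasCompactSupport f → tsupport f ⊆ Ω →
      0 ≤ ∫ x in Ω,
        ((∑ i, ∑ j, ginv F x i j * pd i f x * pd j f x) - normA2 F ν x * f x ^ 2)
          * Real.exp (-(Sfun F W x)) * Real.sqrt (gmat F x).det := by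
  intro f hf hfc hfs
  have hF' : ∀ y ∈ Ω, ∀ b, ContDiffAt ℝ (⊤ : ℕ∞) (fun y => F y b) y := fun y hy b =>
    contDiffAt_pi.1 (hF.contDiffAt (hΩo.mem_nhds hy)) b
  have hν' : ∀ y ∈ Ω, ∀ b, ContDiffAt ℝ (⊤ : ℕ∞) (fun y => ν y b) y := fun y hy b =>
    contDiffAt_pi.1 (hν.contDiffAt (hΩo.mem_nhds hy)) b
  have hzero (i : Fin n) {y} (hy : y ∉ tsupport f) : weightedFlux F W f i =ᶠ[𝓝 y] 0 := by
    filter_upwards [notMem_tsupport_iff_eventuallyEq.1 hy] with z hz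
    simp [weightedFlux, hz]
  have hsmooth (i : Fin n) : ContDiff ℝ 1 (weightedFlux F W f i) := by
    refine contDiff_iff_contDiffAt.2 fun y => ?_
    by_cases hy : y ∈ tsupport f
    · exact (contDiffAt_weightedFlux (hF' y (hfs hy)) (himm y (hfs hy)) hf.contDiffAt W i).of_le
        (by exact_mod_cast le_top)
    · exact contDiffAt_const.congr_of_eventuallyEq (hzero i hy)
  have hcs (i : Fin n) : HasCompactSupport (weightedFlux F W f i) := by
    refine hfc.mono' fun y hy => ?_
    by_contra h
    exact hy (hzero i h).self_of_nhds
  have hint : Integrable (fun x => ∑ i, pd i (weightedFlux F W f i) x) :=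
    integrable_finsetSum _ fun i _ => (integral_pd_eq_zero i (hsmooth i) (hcs i)).1
  have hdiv : ∫ x in Ω, a * ∑ i, pd i (weightedFlux F W f i) x = 0 := by
    rw [setIntegral_eq_integral_of_forall_compl_eq_zero, integral_const_mul, integral_finsetSum]
    · simp [fun i => (integral_pd_eq_zero i (hsmooth i) (hcs i)).2]
    · exact fun i _ => (integral_pd_eq_zero i (hsmooth i) (hcs i)).1
    · intro y hy
      have h (i : Fin n) : pd i (weightedFlux F W f i) y = 0 := by
        rw [pd_congr i (hzero i fun h => hy (hfs h))]
        exact pd_const i 0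
      simp [h]
  set I : (Fin n → ℝ) → ℝ := fun x =>
    ((∑ i, ∑ j, ginv F x i j * pd i f x * pd j f x) - normA2 F ν x * f x ^ 2)
      * Real.exp (-(Sfun F W x)) * Real.sqrt (gmat F x).det
  by_cases hI : IntegrableOn I Ω
  · rw [← hdiv]
    refine setIntegral_mono_on (hint.const_mul a).integrableOn hI hΩo.measurableSet fun x hx => ?_
    rw [sum_pd_weightedFlux hΩo hF' himm hν' hνunit hνperp hW hsol hf.contDiffAt hx,
      ← mul_assoc, ← mul_assoc]
    refine mul_le_mul_of_nonneg_right (mul_le_mul_of_nonneg_right ?_ (Real.exp_pos _).le)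
      (Real.sqrt_nonneg _)
    have hgrad := dotProduct_eq_tangent_add_normal (himm x hx) (hνunit x hx) (hνperp x hx) W W
    rw [show ν x ⬝ᵥ W = meanH F ν x from (hsol x hx).symm,
      show W ⬝ᵥ W = 1 by rw [← hW]; simp [dotProduct, pow_two]] at hgrad
    have hcs := two_mul_inner_le (himm x hx) (fun i => pd i f x) ((jac F x).mulVec W) (a * f x)
    have hff : ∑ i, ∑ j, ginv F x i j * pd i f x * pd j f x
        = (fun i => pd i f x) ⬝ᵥ (ginv F x).mulVec fun i => pd i f x := by
      simp only [dotProduct, Matrix.mulVec, Finset.mul_sum]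
      exact Finset.sum_congr rfl fun i _ => Finset.sum_congr rfl fun j _ => by ring
    rw [hff]
    rw [← sub_eq_iff_eq_add] at hgrad
    rw [← hgrad] at hcs
    nlinarith [mul_le_mul_of_nonneg_right (hq x hx) (sq_nonneg (f x))]
  · exact (integral_undef hI).ge
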